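/- Let F ⊆ T_X be a rank-r subbundle of the tangent bundle of a smooth manifold X, closed under Lie bracket (i.e. an involutive distribution). Then through every point z ∈ X there is a chart U ≅ A × B (A ⊆ ℝ^r, B ⊆ ℝ^{n−r} open) in which F|_U equals the span of the first r coordinate vector fields, i.e. F = ker(dπ_B) where π_B : A × B → B is the projection (Frobenius theorem, local product structure form). -/

import Mathlib

/-- Lie bracket of vector fields on `ℝ^n`. -/
noncomputable def lieBracketVF {n : ℕ} (D E : (Fin n → ℝ) → (Fin n → ℝ)) :
    (Fin n → ℝ) → (Fin n → ℝ) :=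
  fun y => fderiv ℝ E y (D y) - fderiv ℝ D y (E y)

open Set Filter Topology
open scoped unitInterval ContDiff

/-- Inverse function theorem: a function which is smooth near `a` with invertible derivative at `a`
restricts to a homeomorphism which is smooth with invertible derivative at every point. -/
theorem exists_openPartialHomeomorph_of_eventually_contDiffAt
    {E F : Type*} [NormedAddCommGroup E] [NormedSpace ℝ E] [CompleteSpace E]
    [NormedAddCommGroup F] [NormedSpace ℝ F] {f : E → F} {a : E} {f' : E ≃L[ℝ] F}
    (hf : ∀ᶠ x in 𝓝 a, ContDiffAt ℝ ∞ f x) (hf' : HasFDerivAt f (f' : E →L[ℝ] F) a) :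
    ∃ Φ : OpenPartialHomeomorph E F, ⇑Φ = f ∧ a ∈ Φ.source ∧
      ∀ x ∈ Φ.source, ContDiffAt ℝ ∞ f x ∧ ∃ e : E ≃L[ℝ] F, HasFDerivAt f (e : E →L[ℝ] F) x := by
  have hfa := hf.self_of_nhds
  have hcont : ContinuousAt (fderiv ℝ f) a :=
    (hfa.fderiv_right (m := 0) (by simp)).continuousAt
  have hinv : ∀ᶠ x in 𝓝 a, fderiv ℝ f x ∈ range ((↑) : (E ≃L[ℝ] F) → E →L[ℝ] F) := by
    apply hcont
    rw [hf'.fderiv]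
    exact f'.nhds
  obtain ⟨O, hO, hOo, haO⟩ := mem_nhds_iff.1 (hf.and hinv)
  refine ⟨(hfa.toOpenPartialHomeomorph f hf' (by simp)).restrOpen O hOo, rfl,
    ⟨hfa.mem_toOpenPartialHomeomorph_source hf' (by simp), haO⟩, fun x hx => ?_⟩
  obtain ⟨h1, e, he⟩ := hO hx.2
  refine ⟨h1, e, ?_⟩
  rw [he]
  exact (h1.differentiableAt (by simp)).hasFDerivAt

namespace ContinuousMap

section Superposition
universe u
/-- Pointwise application of a continuous family of continuous linear maps. -/
noncomputable def pointwiseApply (K : Type*) [TopologicalSpace K] [CompactSpace K]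
    (E F : Type*) [NormedAddCommGroup E] [NormedSpace ℝ E]
    [NormedAddCommGroup F] [NormedSpace ℝ F] :
    C(K, E →L[ℝ] F) →L[ℝ] C(K, E) →L[ℝ] C(K, F) :=
  LinearMap.mkContinuous₂ (E := C(K, E →L[ℝ] F)) (F := C(K, E)) (G := C(K, F))
    (LinearMap.mk₂ ℝ
      (fun (A : C(K, E →L[ℝ] F)) (h : C(K, E)) => (⟨fun s => A s (h s), by fun_prop⟩ : C(K, F)))
      (fun _ _ _ => by ext; simp) (fun _ _ _ => by ext; simp)
      (fun _ _ _ => by ext; simp) (fun _ _ _ => by ext; simp)) 1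
    (fun A h => by
      rw [one_mul, ContinuousMap.norm_le _ (by positivity)]
      exact fun s => (A s).le_of_opNorm_le_of_le (A.norm_coe_le_norm s) (h.norm_coe_le_norm s))

variable {K : Type*} [TopologicalSpace K] [CompactSpace K]
  {E F : Type u} [NormedAddCommGroup E] [NormedSpace ℝ E] [NormedAddCommGroup F] [NormedSpace ℝ F]

@[simp]
theorem pointwiseApply_apply (A : C(K, E →L[ℝ] F)) (h : C(K, E)) (s : K) :
    pointwiseApply K E F A h s = A s (h s) := rfl

theorem hasFDerivAt_postcomp {g : E → F} (hg : ContDiff ℝ 1 g) (γ : C(K, E)) :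
    HasFDerivAt (fun γ : C(K, E) => (⟨g, hg.continuous⟩ : C(E, F)).comp γ)
      (pointwiseApply K E F
        ((⟨fderiv ℝ g, hg.continuous_fderiv (by simp)⟩ : C(E, E →L[ℝ] F)).comp γ)) γ := by
  set D : C(E, E →L[ℝ] F) := ⟨fderiv ℝ g, hg.continuous_fderiv (by simp)⟩
  rw [hasFDerivAt_iff_isLittleO_nhds_zero, Asymptotics.isLittleO_iff]
  intro c hc
  have hD : Continuous fun γ : C(K, E) => D.comp γ := ContinuousMap.continuous_postcomp D
  obtain ⟨δ, hδ, hδD⟩ := Metric.continuousAt_iff (α := C(K, E)) (β := C(K, E →L[ℝ] F)).1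
    (hD.continuousAt (x := γ)) c hc
  filter_upwards [Metric.ball_mem_nhds (0 : C(K, E)) hδ] with h hh
  rw [mem_ball_zero_iff] at hh
  rw [ContinuousMap.norm_le _ (by positivity)]
  intro s
  have hseg : ∀ x ∈ segment ℝ (γ s) (γ s + h s), ‖fderiv ℝ g x - fderiv ℝ g (γ s)‖ ≤ c := by
    intro x hx
    rw [segment_eq_image'] at hx
    obtain ⟨θ, hθ, rfl⟩ := hx
    have h1 : dist (γ + θ • h) γ < δ := by
      rw [dist_eq_norm, add_sub_cancel_left, norm_smul, Real.norm_of_nonneg hθ.1]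
      exact (mul_le_of_le_one_left (norm_nonneg _) hθ.2).trans_lt hh
    have h2 := (ContinuousMap.dist_apply_le_dist s).trans (hδD h1).le
    rw [dist_eq_norm] at h2
    simpa [D] using h2
  have := (convex_segment (γ s) (γ s + h s)).norm_image_sub_le_of_norm_fderiv_le' (𝕜 := ℝ) (f := g)
    (φ := fderiv ℝ g (γ s)) (fun x _ => hg.contDiffAt.differentiableAt (by simp)) hseg
    (left_mem_segment ℝ _ _) (right_mem_segment ℝ _ _)
  rw [add_sub_cancel_left] at this
  exact this.trans (mul_le_mul_of_nonneg_left (h.norm_coe_le_norm s) hc.le)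

theorem contDiff_postcomp {g : E → F} (hg : ContDiff ℝ ∞ g) :
    ContDiff ℝ ∞ (fun γ : C(K, E) => (⟨g, hg.continuous⟩ : C(E, F)).comp γ) := by
  rw [contDiff_infty]
  intro n
  induction n generalizing F with
  | zero => exact contDiff_zero.2 (ContinuousMap.continuous_postcomp _)
  | succ n ih =>
    have hg' : ContDiff ℝ ∞ (fderiv ℝ g) := hg.fderiv_right (by simp)
    rw [Nat.cast_add, Nat.cast_one, contDiff_succ_iff_hasFDerivAt (n := n)]
    exact ⟨_, (pointwiseApply K E F).contDiff.comp (ih hg'),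
      hasFDerivAt_postcomp (hg.of_le (by simp))⟩

end Superposition

/-- The primitive vanishing at `0`. -/
noncomputable def primitive (E : Type*) [NormedAddCommGroup E] [NormedSpace ℝ E] [CompleteSpace E] :
    C(I, E) →L[ℝ] C(I, E) :=
  LinearMap.mkContinuous
    { toFun := fun h => ⟨fun t => ∫ s in (0 : ℝ)..t, IccExtend zero_le_one h s,
        (intervalIntegral.continuous_primitive
          (fun a b => (h.continuous.Icc_extend' (h := zero_le_one)).intervalIntegrable a b) 0).comp
          continuous_subtype_val⟩
      map_add' := fun h k => by
        ext t
        have hh := (h.continuous.Icc_extend' (h := zero_le_one)).intervalIntegrable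
          (μ := MeasureTheory.volume) 0 t
        have hk := (k.continuous.Icc_extend' (h := zero_le_one)).intervalIntegrable
          (μ := MeasureTheory.volume) 0 t
        exact intervalIntegral.integral_add hh hk
      map_smul' := fun c h => by
        ext t
        exact intervalIntegral.integral_smul c _ } 1
    (fun h => by
      rw [one_mul, ContinuousMap.norm_le _ (norm_nonneg _)]
      intro t
      refine (intervalIntegral.norm_integral_le_of_norm_le_const
        (fun s _ => h.norm_coe_le_norm _)).trans ?_
      rw [sub_zero, abs_of_nonneg t.2.1]
      exact mul_le_of_le_one_right (norm_nonneg _) t.2.2)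

theorem primitive_apply {E : Type*} [NormedAddCommGroup E] [NormedSpace ℝ E] [CompleteSpace E]
    (h : C(I, E)) (t : I) :
    primitive E h t = ∫ s in (0 : ℝ)..t, IccExtend zero_le_one h s := rfl

theorem hasDerivAt_integral_IccExtend {E : Type*} [NormedAddCommGroup E] [NormedSpace ℝ E]
    [CompleteSpace E] (h : C(I, E)) (t : ℝ) :
    HasDerivAt (fun t => ∫ s in (0 : ℝ)..t, IccExtend zero_le_one h s)
      (IccExtend zero_le_one h t) t :=
  (h.continuous.Icc_extend' (h := zero_le_one)).integral_hasStrictDerivAt 0 t |>.hasDerivAt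

end ContinuousMap

section Foliation
universe u
variable {E₁ E₂ : Type u} [NormedAddCommGroup E₁] [NormedSpace ℝ E₁]
  [NormedAddCommGroup E₂] [NormedSpace ℝ E₂]

/-- The point `x` and a curve `γ` determine the curve `s ↦ ((1 - s) x, γ s, x)`. -/
noncomputable def radialCurve (E₁ E₂ : Type u) [NormedAddCommGroup E₁] [NormedSpace ℝ E₁]
    [NormedAddCommGroup E₂] [NormedSpace ℝ E₂] :
    E₁ × C(I, E₂) →L[ℝ] C(I, (E₁ × E₂) × E₁) :=
  LinearMap.mkContinuous
    { toFun := fun q => (⟨fun s => (((1 - (s : ℝ)) • q.1, q.2 s), q.1), by fun_prop⟩ :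
        C(I, (E₁ × E₂) × E₁))
      map_add' := fun q q' => by ext s <;> simp
      map_smul' := fun c q => by ext s <;> simp [smul_comm c] } 1
    (fun q => by
      rw [one_mul, ContinuousMap.norm_le _ (norm_nonneg _)]
      intro s
      refine norm_prod_le_iff.2 ⟨norm_prod_le_iff.2 ⟨?_, ?_⟩, norm_fst_le q⟩
      · change ‖(1 - (s : ℝ)) • q.1‖ ≤ _
        rw [norm_smul, Real.norm_of_nonneg (sub_nonneg.2 s.2.2)]
        exact (mul_le_of_le_one_left (norm_nonneg _) (by linarith [s.2.1])).trans (norm_fst_le q)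
      · exact (q.2.norm_coe_le_norm s).trans (norm_snd_le q))

@[simp]
theorem radialCurve_apply (q : E₁ × C(I, E₂)) (s : I) :
    radialCurve E₁ E₂ q s = (((1 - (s : ℝ)) • q.1, q.2 s), q.1) := rfl

variable {f : E₁ × E₂ → E₁ →L[ℝ] E₂}

theorem contDiff_uncurry_apply (hf : ContDiff ℝ ∞ f) :
    ContDiff ℝ ∞ fun q : (E₁ × E₂) × E₁ => f q.1 q.2 :=
  (hf.comp contDiff_fst).clm_apply contDiff_snd

theorem fderiv_uncurry_apply (hf : ContDiff ℝ ∞ f) (q h : (E₁ × E₂) × E₁) :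
    fderiv ℝ (fun q : (E₁ × E₂) × E₁ => f q.1 q.2) q h = fderiv ℝ f q.1 h.1 q.2 + f q.1 h.2 := by
  have h1 : HasFDerivAt (fun q : (E₁ × E₂) × E₁ => f q.1)
      ((fderiv ℝ f q.1).comp (ContinuousLinearMap.fst ℝ _ _)) q :=
    ((hf.differentiable (by simp)) q.1).hasFDerivAt.comp q hasFDerivAt_fst
  rw [(h1.clm_apply hasFDerivAt_snd).fderiv]
  simp [add_comm]

/-- The velocity `s ↦ f ((1 - s) x, γ s) x` along the curve `radialCurve (x, γ)`. -/
noncomputable def radialVelocity (hf : ContDiff ℝ ∞ f) (q : E₁ × C(I, E₂)) : C(I, E₂) :=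
  (⟨fun q : (E₁ × E₂) × E₁ => f q.1 q.2, (contDiff_uncurry_apply hf).continuous⟩ :
    C((E₁ × E₂) × E₁, E₂)).comp (radialCurve E₁ E₂ q)

theorem radialVelocity_apply (hf : ContDiff ℝ ∞ f) (q : E₁ × C(I, E₂)) (s : I) :
    radialVelocity hf q s = f ((1 - (s : ℝ)) • q.1, q.2 s) q.1 := rfl

theorem contDiff_radialVelocity (hf : ContDiff ℝ ∞ f) : ContDiff ℝ ∞ (radialVelocity hf) :=
  (ContinuousMap.contDiff_postcomp (contDiff_uncurry_apply hf)).comp (radialCurve E₁ E₂).contDiff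

theorem fderiv_radialVelocity_apply (hf : ContDiff ℝ ∞ f) (q h : E₁ × C(I, E₂)) (s : I) :
    fderiv ℝ (radialVelocity hf) q h s =
      fderiv ℝ f ((1 - (s : ℝ)) • q.1, q.2 s) ((1 - (s : ℝ)) • h.1, h.2 s) q.1 +
        f ((1 - (s : ℝ)) • q.1, q.2 s) h.1 := by
  have h1 : HasFDerivAt (radialVelocity hf) _ q :=
    (ContinuousMap.hasFDerivAt_postcomp ((contDiff_uncurry_apply hf).of_le (by simp))
      (radialCurve E₁ E₂ q)).comp q (radialCurve E₁ E₂).hasFDerivAt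
  rw [h1.fderiv]
  exact fderiv_uncurry_apply hf _ _

variable [CompleteSpace E₂]

/-- Smooth dependence of the solution of `γ' = -f ((1 - s) x, γ) x`, `γ 0 = y`, on `(x, y)`. -/
theorem exists_contDiffAt_radial_solution [CompleteSpace E₁] (hf : ContDiff ℝ ∞ f) :
    ∃ Γ : E₁ × E₂ → C(I, E₂), Γ 0 = 0 ∧ ∀ᶠ p in 𝓝 0, ContDiffAt ℝ ∞ Γ p ∧
      Γ p = ContinuousLinearMap.const ℝ I p.2 -
        ContinuousMap.primitive E₂ (radialVelocity hf (p.1, Γ p)) := by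
  set T : (E₁ × E₂) × C(I, E₂) → (E₁ × E₂) × C(I, E₂) := fun q =>
    (q.1, q.2 - ContinuousLinearMap.const ℝ I q.1.2 +
      ContinuousMap.primitive E₂ (radialVelocity hf (q.1.1, q.2))) with hT
  have hTs : ContDiff ℝ ∞ T := by
    refine contDiff_fst.prodMk ((contDiff_snd.sub ?_).add ?_)
    · exact (ContinuousLinearMap.const ℝ I : E₂ →L[ℝ] C(I, E₂)).contDiff.comp (contDiff_snd.comp contDiff_fst)
    · exact (ContinuousMap.primitive E₂).contDiff.comp ((contDiff_radialVelocity hf).comp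
        ((contDiff_fst.comp contDiff_fst).prodMk contDiff_snd))
  have hT0 : T 0 = 0 := by
    have : radialVelocity hf ((0 : E₁), (0 : C(I, E₂))) = 0 := by ext s; simp [radialVelocity_apply]
    simp [hT, this]
  obtain ⟨S, hS⟩ : ∃ S : E₁ × E₂ →L[ℝ] C(I, E₂), HasFDerivAt T
      (((ContinuousLinearEquiv.refl ℝ (E₁ × E₂)).skewProd (ContinuousLinearEquiv.refl ℝ C(I, E₂)) S :
        _ ≃L[ℝ] _) : _ →L[ℝ] _) 0 := by
    set N := fderiv ℝ (radialVelocity hf) 0 with hN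
    have hNd : HasFDerivAt (radialVelocity hf) N 0 :=
      ((contDiff_radialVelocity hf).differentiable (by simp) 0).hasFDerivAt
    have hN' : ∀ h : E₁ × C(I, E₂), N h = N (h.1, 0) := by
      intro h
      ext s
      simp [hN, fderiv_radialVelocity_apply]
    let π : (E₁ × E₂) × C(I, E₂) →L[ℝ] E₁ × C(I, E₂) :=
      ((ContinuousLinearMap.fst ℝ E₁ E₂).comp (ContinuousLinearMap.fst ℝ _ _)).prod
        (ContinuousLinearMap.snd ℝ _ _)
    let c : E₂ →L[ℝ] C(I, E₂) := ContinuousLinearMap.const ℝ I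
    have hd : HasFDerivAt T ((ContinuousLinearMap.fst ℝ (E₁ × E₂) C(I, E₂)).prod
        (ContinuousLinearMap.snd ℝ _ _ - c.comp
          ((ContinuousLinearMap.snd ℝ E₁ E₂).comp (ContinuousLinearMap.fst ℝ _ _)) +
          ((ContinuousMap.primitive E₂).comp N).comp π)) 0 := by
      refine hasFDerivAt_fst.prodMk ((hasFDerivAt_snd.sub ?_).add ?_)
      · let L : (E₁ × E₂) × C(I, E₂) →L[ℝ] C(I, E₂) :=
          c.comp ((ContinuousLinearMap.snd ℝ E₁ E₂).comp (ContinuousLinearMap.fst ℝ _ _))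
        exact L.hasFDerivAt
      · exact ((ContinuousMap.primitive E₂).hasFDerivAt.comp _ hNd).comp
          (0 : (E₁ × E₂) × C(I, E₂)) π.hasFDerivAt
    refine ⟨((ContinuousMap.primitive E₂).comp N).comp ((ContinuousLinearMap.inl ℝ _ _).comp
      (ContinuousLinearMap.fst ℝ E₁ E₂)) - c.comp (ContinuousLinearMap.snd ℝ E₁ E₂),
      hd.congr_fderiv ?_⟩
    refine ContinuousLinearMap.ext fun q => Prod.ext rfl ?_
    change q.2 - c q.1.2 + ContinuousMap.primitive E₂ (N (π q)) =
      q.2 + (ContinuousMap.primitive E₂ (N (q.1.1, 0)) - c q.1.2)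
    rw [hN' (π q)]
    change q.2 - c q.1.2 + ContinuousMap.primitive E₂ (N (q.1.1, 0)) = _
    abel
  obtain ⟨Φ, hΦ, h0, hΦs⟩ := exists_openPartialHomeomorph_of_eventually_contDiffAt
    (Eventually.of_forall fun x => hTs.contDiffAt) hS
  have h0t : (0 : (E₁ × E₂) × C(I, E₂)) ∈ Φ.target := by
    rw [← hT0, ← hΦ]; exact Φ.map_source h0
  have hsm : ∀ᶠ p : E₁ × E₂ in 𝓝 0, (p, (0 : C(I, E₂))) ∈ Φ.target := by
    have : ContinuousAt (fun p : E₁ × E₂ => (p, (0 : C(I, E₂)))) 0 := by fun_prop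
    exact this (Φ.open_target.mem_nhds h0t)
  refine ⟨fun p => (Φ.symm (p, 0)).2, ?_, ?_⟩
  · have : Φ.symm 0 = 0 := by
      have := Φ.left_inv h0
      rwa [hΦ, hT0] at this
    simp [show ((0 : E₁ × E₂), (0 : C(I, E₂))) = 0 from rfl, this]
  · filter_upwards [hsm] with p hp
    obtain ⟨h1, e, he⟩ := hΦs _ (Φ.map_target hp)
    rw [← hΦ] at h1 he
    constructor
    · exact contDiffAt_snd.comp _ ((Φ.contDiffAt_symm hp he h1).comp p
        (contDiffAt_id.prodMk contDiffAt_const))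
    · have h2 := Φ.right_inv hp
      rw [hΦ, hT, Prod.mk.injEq] at h2
      obtain ⟨h3, h4⟩ := h2
      rw [h3] at h4
      rw [sub_add_eq_add_sub, sub_eq_zero] at h4
      exact eq_sub_of_add_eq h4

/-- If the plane field `v ↦ (v, f p v)` is integrable, the variation of a radial solution in a
direction tangent to the plane field vanishes at time `1`. -/
theorem radial_variation_eq_zero (hf : ContDiff ℝ ∞ f) {p : E₁ × E₂} {γ η : C(I, E₂)} {w : E₁}
    (hcurv : ∀ s : I, ∀ v w, fderiv ℝ f ((1 - (s : ℝ)) • p.1, γ s)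
      (v, f ((1 - (s : ℝ)) • p.1, γ s) v) w =
        fderiv ℝ f ((1 - (s : ℝ)) • p.1, γ s) (w, f ((1 - (s : ℝ)) • p.1, γ s) w) v)
    (hγ : γ = ContinuousLinearMap.const ℝ I p.2 -
      ContinuousMap.primitive E₂ (radialVelocity hf (p.1, γ)))
    (hη : η = ContinuousLinearMap.const ℝ I (f p w) -
      ContinuousMap.primitive E₂ (fderiv ℝ (radialVelocity hf) (p.1, γ) (w, η))) :
    η 1 = 0 := by
  set k := radialVelocity hf (p.1, γ) with hk
  set l := fderiv ℝ (radialVelocity hf) (p.1, γ) (w, η) with hl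
  let γ' : ℝ → E₂ := fun t => p.2 - ∫ s in (0 : ℝ)..t, IccExtend zero_le_one k s
  let η' : ℝ → E₂ := fun t => f p w - ∫ s in (0 : ℝ)..t, IccExtend zero_le_one l s
  have hγ' : ∀ s : I, γ s = γ' s := fun s => congrArg (· s) hγ
  have hη' : ∀ s : I, η s = η' s := fun s => congrArg (· s) hη
  let P : ℝ → E₁ × E₂ := fun s => ((1 - s) • p.1, γ' s)
  let W : ℝ → E₂ := fun s => η' s - (1 - s) • f (P s) w
  have hγd : ∀ s, HasDerivAt γ' (-IccExtend zero_le_one k s) s := fun s =>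
    (ContinuousMap.hasDerivAt_integral_IccExtend k s).const_sub p.2
  have hηd : ∀ s, HasDerivAt η' (-IccExtend zero_le_one l s) s := fun s =>
    (ContinuousMap.hasDerivAt_integral_IccExtend l s).const_sub (f p w)
  have h1 : ∀ s : ℝ, HasDerivAt (fun s : ℝ => 1 - s) (-1) s := fun s => by
    simpa using (hasDerivAt_id s).const_sub 1
  have hPd : ∀ s, HasDerivAt P (-p.1, -IccExtend zero_le_one k s) s := fun s => by
    simpa using ((h1 s).smul_const p.1).prodMk (hγd s)
  have hWd : ∀ s, HasDerivAt W (-IccExtend zero_le_one l s - ((1 - s) •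
      fderiv ℝ f (P s) (-p.1, -IccExtend zero_le_one k s) w + (-1 : ℝ) • f (P s) w)) s := by
    intro s
    refine (hηd s).sub ((h1 s).smul ?_)
    have h2 : HasDerivAt (fun s => f (P s)) _ s :=
      ((hf.differentiable (by simp)) (P s)).hasFDerivAt.comp_hasDerivAt s (hPd s)
    simpa using h2.clm_apply (hasDerivAt_const s w)
  have hPc : Continuous P := continuous_iff_continuousAt.2 fun s => (hPd s).continuousAt
  obtain ⟨M, hM⟩ := isCompact_Icc.exists_bound_of_continuousOn (s := Icc (0 : ℝ) 1)
    ((hf.continuous_fderiv (by simp)).comp hPc).continuousOn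
  have hW0 : W 0 = 0 := by simp [W, η', P, γ']
  have key := eq_zero_of_abs_deriv_le_mul_abs_self_of_eq_zero_right (K := M * ‖p.1‖) (a := 0)
    (b := 1) (fun s _ => (hWd s).continuousAt.continuousWithinAt)
    (fun s _ => (hWd s).hasDerivWithinAt) hW0 ?_ 1 (by simp)
  · rw [hη' 1]
    simpa [W] using key
  intro s hs
  have hs' : s ∈ I := Ico_subset_Icc_self hs
  have hPs : ((1 - s) • p.1, γ ⟨s, hs'⟩) = P s := by rw [hγ' ⟨s, hs'⟩]
  have hks : IccExtend zero_le_one k s = f (P s) p.1 := by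
    rw [IccExtend_of_mem _ _ hs', ← hPs]; rfl
  have hls : IccExtend zero_le_one l s =
      fderiv ℝ f (P s) ((1 - s) • w, η' s) p.1 + f (P s) w := by
    rw [IccExtend_of_mem _ _ hs', hl, fderiv_radialVelocity_apply, ← hη' ⟨s, hs'⟩, ← hPs]
  have hi := hcurv ⟨s, hs'⟩ w p.1
  rw [hPs] at hi
  have hW : (-IccExtend zero_le_one l s - ((1 - s) •
      fderiv ℝ f (P s) (-p.1, -IccExtend zero_le_one k s) w + (-1 : ℝ) • f (P s) w)) =
      - fderiv ℝ f (P s) (0, W s) p.1 := by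
    have e1 : ((1 - s) • w, η' s) = (1 - s) • (w, f (P s) w) + (0, W s) := by
      ext <;> simp [W]
    have e2 : (-p.1, -f (P s) p.1) = - (p.1, f (P s) p.1) := rfl
    rw [hls, hks, e1, e2, map_add, map_neg, map_smul]
    simp only [add_apply, neg_apply, smul_apply]
    rw [hi]
    module
  rw [hW, norm_neg]
  refine ((fderiv ℝ f (P s) (0, W s)).le_opNorm p.1).trans ?_
  have h3 : ‖((0 : E₁), W s)‖ = ‖W s‖ := by simp [Prod.norm_def]
  have h4 := (fderiv ℝ f (P s)).le_of_opNorm_le (hM s hs') (0, W s)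
  rw [h3] at h4
  calc _ ≤ M * ‖W s‖ * ‖p.1‖ := by gcongr
    _ = _ := by ring

/-- First integrals of the integrable plane field `v ↦ (v, f p v)`. -/
theorem exists_first_integrals [CompleteSpace E₁] (hf : ContDiff ℝ ∞ f)
    (hcurv : ∀ᶠ p in 𝓝 0, ∀ v w, fderiv ℝ f p (v, f p v) w = fderiv ℝ f p (w, f p w) v) :
    ∃ Q : E₁ × E₂ → E₂, (∀ᶠ p in 𝓝 0, ContDiffAt ℝ ∞ Q p) ∧
      (∀ᶠ p in 𝓝 0, ∀ w, fderiv ℝ Q p (w, f p w) = 0) ∧ ∀ v, fderiv ℝ Q 0 (0, v) = v := by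
  obtain ⟨Γ, hΓ0, hΓ⟩ := exists_contDiffAt_radial_solution hf
  let ev : C(I, E₂) →L[ℝ] E₂ := ContinuousMap.evalCLM ℝ (1 : I)
  have hvar : ∀ᶠ p in 𝓝 0, ∀ u, fderiv ℝ Γ p u = ContinuousLinearMap.const ℝ I u.2 -
      ContinuousMap.primitive E₂
        (fderiv ℝ (radialVelocity hf) (p.1, Γ p) (u.1, fderiv ℝ Γ p u)) := by
    filter_upwards [eventually_eventually_nhds.2 hΓ] with p hp u
    have hd : HasFDerivAt Γ (fderiv ℝ Γ p) p :=
      (hp.self_of_nhds.1.differentiableAt (by simp)).hasFDerivAt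
    let c : E₁ × E₂ →L[ℝ] C(I, E₂) :=
      (ContinuousLinearMap.const ℝ I : E₂ →L[ℝ] C(I, E₂)).comp (ContinuousLinearMap.snd ℝ E₁ E₂)
    have hN : HasFDerivAt (radialVelocity hf) _ (p.1, Γ p) :=
      ((contDiff_radialVelocity hf).differentiable (by simp) (p.1, Γ p)).hasFDerivAt
    have hr := c.hasFDerivAt.sub ((ContinuousMap.primitive E₂).hasFDerivAt.comp p
      (hN.comp p (hasFDerivAt_fst.prodMk hd)))
    have heq : Γ =ᶠ[𝓝 p] fun q => c q - ContinuousMap.primitive E₂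
        (radialVelocity hf (q.1, Γ q)) := hp.mono fun q hq => hq.2
    exact congrArg (· u) (hd.unique (hr.congr_of_eventuallyEq heq))
  have hev : ∀ᶠ p in 𝓝 0, ∀ u, fderiv ℝ (fun p => Γ p 1) p u = fderiv ℝ Γ p u 1 := by
    filter_upwards [hΓ] with p hp u
    have hd : HasFDerivAt Γ (fderiv ℝ Γ p) p := (hp.1.differentiableAt (by simp)).hasFDerivAt
    have h2 : HasFDerivAt (fun p => Γ p 1) (ev.comp (fderiv ℝ Γ p)) p := ev.hasFDerivAt.comp p hd
    rw [h2.fderiv]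
    rfl
  refine ⟨fun p => Γ p 1, hΓ.mono fun p hp => ev.contDiff.contDiffAt.comp p hp.1, ?_, fun v => ?_⟩
  · obtain ⟨ε, hε, hball⟩ := Metric.eventually_nhds_iff_ball.1 hcurv
    have hΓc : ContinuousAt Γ 0 := hΓ.self_of_nhds.1.continuousAt
    have hsmall : ∀ᶠ p in 𝓝 0, ‖Γ p‖ < ε := by
      have := hΓc.norm
      rw [ContinuousAt, hΓ0, norm_zero] at this
      exact this.eventually_lt_const hε
    filter_upwards [hΓ, hvar, hev, hsmall, Metric.ball_mem_nhds _ hε] with p h1 h2 h3 h4 h5 w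
    rw [h3]
    rw [mem_ball_zero_iff] at h5
    refine radial_variation_eq_zero hf (p := p) (w := w) (fun s v w => hball _ ?_ v w) h1.2
      (h2 (w, f p w))
    rw [mem_ball_zero_iff]
    refine lt_of_le_of_lt ?_ (max_lt h5 h4)
    refine norm_prod_le_iff.2 ⟨le_max_of_le_left ?_, le_max_of_le_right ((Γ p).norm_coe_le_norm s)⟩
    rw [norm_smul, Real.norm_of_nonneg (sub_nonneg.2 s.2.2)]
    exact (mul_le_of_le_one_left (norm_nonneg _) (by linarith [s.2.1])).trans (norm_fst_le p)
  · have h := hvar.self_of_nhds (0, v)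
    have hz : fderiv ℝ (radialVelocity hf) ((0 : E₁ × E₂).1, Γ 0)
        ((0 : E₁), fderiv ℝ Γ 0 (0, v)) = 0 := by
      ext s
      simp [fderiv_radialVelocity_apply]
    rw [hev.self_of_nhds]
    rw [hz, map_zero, sub_zero] at h
    rw [h]
    rfl

end Foliation

/-- A function which is smooth near `0` agrees near `0` with a globally smooth function. -/
theorem exists_contDiff_eventuallyEq {E G : Type*} [NormedAddCommGroup E] [NormedSpace ℝ E]
    [FiniteDimensional ℝ E] [NormedAddCommGroup G] [NormedSpace ℝ G] {f : E → G}
    (hf : ∀ᶠ x in 𝓝 0, ContDiffAt ℝ ∞ f x) : ∃ g : E → G, ContDiff ℝ ∞ g ∧ g =ᶠ[𝓝 0] f := by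
  obtain ⟨ε, hε, hball⟩ := Metric.eventually_nhds_iff_ball.1 hf
  let b : ContDiffBump (0 : E) := ⟨ε / 4, ε / 2, by positivity, by linarith⟩
  refine ⟨fun x => b x • f x, contDiff_iff_contDiffAt.2 fun x => ?_,
    b.eventuallyEq_one.mono fun x hx => by simp [hx]⟩
  by_cases hx : x ∈ Metric.ball 0 ε
  · exact b.contDiff.contDiffAt.smul (hball x hx)
  · have hx' : x ∉ tsupport b := by
      rw [b.tsupport_eq]
      exact fun h => hx (Metric.closedBall_subset_ball (by change ε / 2 < ε; linarith) h)
    refine contDiffAt_const (c := (0 : G)) |>.congr_of_eventuallyEq ?_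
    filter_upwards [notMem_tsupport_iff_eventuallyEq.1 hx'] with y hy
    simp [hy]

theorem exists_equiv_prod_of_finrank_range {n r : ℕ} (hrn : r ≤ n)
    (l : (Fin r → ℝ) →ₗ[ℝ] (Fin n → ℝ)) (hl : Module.finrank ℝ l.range = r) :
    ∃ e : (Fin n → ℝ) ≃L[ℝ] (Fin r → ℝ) × (Fin (n - r) → ℝ), ∀ c, e (l c) = (c, 0) := by
  obtain ⟨C, hC⟩ := Submodule.exists_isCompl l.range
  have hfin := Submodule.finrank_add_eq_of_isCompl hC
  rw [hl, Module.finrank_fin_fun] at hfin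
  let m : (Fin (n - r) → ℝ) ≃ₗ[ℝ] C := LinearEquiv.ofFinrankEq _ _ (by
    rw [Module.finrank_fin_fun]; omega)
  have hinj : Function.Injective l := by
    rw [← LinearMap.ker_eq_bot, ← Submodule.finrank_eq_zero]
    have := l.finrank_range_add_finrank_ker
    rw [hl, Module.finrank_fin_fun] at this
    omega
  let L := l.coprod (C.subtype.comp m.toLinearMap)
  have hL : Function.Injective L := by
    rw [← LinearMap.ker_eq_bot, LinearMap.ker_coprod_of_disjoint_range, Submodule.prod_eq_bot_iff]
    · exact ⟨LinearMap.ker_eq_bot.2 hinj,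
        LinearMap.ker_eq_bot.2 (Subtype.val_injective.comp m.injective)⟩
    · refine hC.disjoint.mono_right ?_
      rintro _ ⟨x, rfl⟩
      exact (m x).2
  let e := LinearEquiv.ofInjectiveOfFinrankEq L hL (by simp; omega)
  refine ⟨e.symm.toContinuousLinearEquiv, fun c => ?_⟩
  change e.symm (l c) = _
  rw [LinearEquiv.symm_apply_eq]
  change l c = L (c, 0)
  simp [L]

/-- In suitable linear coordinates, a smooth distribution is locally the graph of a smooth family
of linear maps. -/
theorem exists_graph_coordinates {n r : ℕ} (hrn : r ≤ n)
    {F : (Fin n → ℝ) → Submodule ℝ (Fin n → ℝ)} {z : Fin n → ℝ}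
    (hrank : Module.finrank ℝ (F z) = r) {V : Fin r → (Fin n → ℝ) → (Fin n → ℝ)}
    (hV : ∀ i, ∀ᶠ y in 𝓝 z, ContDiffAt ℝ ∞ (V i) y)
    (hF : ∀ᶠ y in 𝓝 z, F y = Submodule.span ℝ (range fun i => V i y)) :
    ∃ (e : (Fin n → ℝ) ≃L[ℝ] (Fin r → ℝ) × (Fin (n - r) → ℝ))
      (f : (Fin r → ℝ) × (Fin (n - r) → ℝ) → (Fin r → ℝ) →L[ℝ] (Fin (n - r) → ℝ)),
      ContDiff ℝ ∞ f ∧ ∀ᶠ p in 𝓝 0, ∀ v, v ∈ F (z + e.symm p) ↔ (e v).2 = f p (e v).1 := by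
  let l : (Fin n → ℝ) → (Fin r → ℝ) →L[ℝ] (Fin n → ℝ) := fun y =>
    ∑ i, (ContinuousLinearMap.proj (R := ℝ) (φ := fun _ : Fin r => ℝ) i).smulRight (V i y)
  have hl : ∀ y c, l y c = ∑ i, c i • V i y := fun y c => by simp [l]
  have hlF : ∀ᶠ y in 𝓝 z, ∀ v, v ∈ F y ↔ ∃ c, l y c = v := hF.mono fun y hy v => by
    rw [hy, Submodule.mem_span_range_iff_exists_fun]
    simp only [hl]
  have hls : ∀ᶠ y in 𝓝 z, ContDiffAt ℝ ∞ l y := by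
    filter_upwards [eventually_all.2 hV] with y hy
    refine ContDiffAt.sum fun i _ => ?_
    exact (ContinuousLinearMap.smulRightL ℝ (Fin r → ℝ) (Fin n → ℝ)
      (ContinuousLinearMap.proj (R := ℝ) (φ := fun _ : Fin r => ℝ) i)).contDiff.contDiffAt.comp y
        (hy i)
  obtain ⟨e, he⟩ := exists_equiv_prod_of_finrank_range hrn (l z).toLinearMap (by
    rw [show (l z).toLinearMap.range = F z from
      Submodule.ext fun v => (hlF.self_of_nhds v).symm, hrank])
  let τ : (Fin r → ℝ) × (Fin (n - r) → ℝ) → (Fin n → ℝ) := fun p => z + e.symm p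
  have hτ : ContDiff ℝ ∞ τ := contDiff_const.add e.symm.contDiff
  have hτ0 : Tendsto τ (𝓝 0) (𝓝 z) := by
    have := hτ.continuous.tendsto 0
    simpa [τ] using this
  let A : (Fin r → ℝ) × (Fin (n - r) → ℝ) → (Fin r → ℝ) →L[ℝ] (Fin r → ℝ) := fun p =>
    ((ContinuousLinearMap.fst ℝ _ _).comp e.toContinuousLinearMap).comp (l (τ p))
  let B : (Fin r → ℝ) × (Fin (n - r) → ℝ) → (Fin r → ℝ) →L[ℝ] (Fin (n - r) → ℝ) := fun p =>
    ((ContinuousLinearMap.snd ℝ _ _).comp e.toContinuousLinearMap).comp (l (τ p))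
  have hAs : ∀ᶠ p in 𝓝 0, ContDiffAt ℝ ∞ A p := (hτ0.eventually hls).mono fun p hp =>
    contDiffAt_const.clm_comp (hp.comp p hτ.contDiffAt)
  have hBs : ∀ᶠ p in 𝓝 0, ContDiffAt ℝ ∞ B p := (hτ0.eventually hls).mono fun p hp =>
    contDiffAt_const.clm_comp (hp.comp p hτ.contDiffAt)
  have hA0 : A 0 = ContinuousLinearEquiv.refl ℝ (Fin r → ℝ) := by
    ext1 c
    have : e (l z c) = (c, 0) := he c
    simp [A, τ, this]
  have hAi : ∀ᶠ p in 𝓝 0, A p ∈ range ((↑) : ((Fin r → ℝ) ≃L[ℝ] (Fin r → ℝ)) → _) := by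
    have := hAs.self_of_nhds.continuousAt
    apply this
    rw [hA0]
    exact ContinuousLinearEquiv.nhds _
  obtain ⟨f, hf, hfe⟩ := exists_contDiff_eventuallyEq (f := fun p => (B p).comp (A p).inverse) (by
    filter_upwards [hAs, hBs, hAi] with p hA hB ⟨a, ha⟩
    refine hB.clm_comp (ContDiffAt.comp (g := ContinuousLinearMap.inverse) p ?_ hA)
    rw [← ha]
    exact contDiffAt_map_inverse a)
  refine ⟨e, f, hf, ?_⟩
  filter_upwards [hfe, hAi, hτ0.eventually hlF] with p hp ⟨a, ha⟩ hFp v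
  rw [hp, hFp, ← ha, ContinuousLinearMap.inverse_equiv]
  have haA : ∀ c, a c = (e (l (τ p) c)).1 := fun c => congrArg (· c) ha
  constructor
  · rintro ⟨c, rfl⟩
    simp [← haA, B]
  · intro h
    refine ⟨a.symm (e v).1, e.injective (Prod.ext ?_ ?_)⟩
    · rw [← haA, a.apply_symm_apply]
    · rw [h]; rfl

/-- Involutivity of a distribution given as the graph of `f` makes the plane field of `f`
integrable. -/
theorem integrable_of_involutive {n : ℕ} {E₁ E₂ : Type*} [NormedAddCommGroup E₁] [NormedSpace ℝ E₁]
    [NormedAddCommGroup E₂] [NormedSpace ℝ E₂] {X : Set (Fin n → ℝ)} (hX : IsOpen X)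
    {F : (Fin n → ℝ) → Submodule ℝ (Fin n → ℝ)}
    (hinv : ∀ U : Set (Fin n → ℝ), IsOpen U → U ⊆ X →
      ∀ D E : (Fin n → ℝ) → (Fin n → ℝ),
        ContDiffOn ℝ (⊤ : ℕ∞) D U → ContDiffOn ℝ (⊤ : ℕ∞) E U →
        (∀ y ∈ U, D y ∈ F y) → (∀ y ∈ U, E y ∈ F y) →
        ∀ y ∈ U, lieBracketVF D E y ∈ F y)
    {z : Fin n → ℝ} (hz : z ∈ X) (e : (Fin n → ℝ) ≃L[ℝ] E₁ × E₂) {f : E₁ × E₂ → E₁ →L[ℝ] E₂}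
    (hf : ContDiff ℝ ∞ f)
    (hF : ∀ᶠ p in 𝓝 0, ∀ v, v ∈ F (z + e.symm p) ↔ (e v).2 = f p (e v).1) :
    ∀ᶠ p in 𝓝 0, ∀ v w, fderiv ℝ f p (v, f p v) w = fderiv ℝ f p (w, f p w) v := by
  have hτ0 : Tendsto (fun y => e (y - z)) (𝓝 z) (𝓝 0) := by
    have : Continuous fun y => e (y - z) := by fun_prop
    simpa using this.tendsto z
  have hσ0 : Tendsto (fun p => z + e.symm p) (𝓝 0) (𝓝 z) := by
    have : Continuous fun p => z + e.symm p := by fun_prop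
    simpa using this.tendsto 0
  obtain ⟨U, hU, hUo, hzU⟩ := mem_nhds_iff.1 ((hτ0.eventually hF).and (hX.mem_nhds hz))
  have hFU : ∀ y ∈ U, ∀ v, v ∈ F y ↔ (e v).2 = f (e (y - z)) (e v).1 := fun y hy v => by
    simpa using (hU hy).1 v
  filter_upwards [hσ0 (hUo.mem_nhds hzU)] with p hp v w
  let D : E₁ → (Fin n → ℝ) → (Fin n → ℝ) := fun v y => e.symm (v, f (e (y - z)) v)
  have hD : ∀ v, ContDiff ℝ ∞ (D v) := fun v => by
    refine e.symm.contDiff.comp (contDiff_const.prodMk (ContDiff.clm_apply (hf.comp ?_)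
      contDiff_const))
    exact e.contDiff.comp (contDiff_id.sub contDiff_const)
  have hDF : ∀ v, ∀ y ∈ U, D v y ∈ F y := fun v y hy => by
    rw [hFU y hy]
    simp [D]
  have hDd : ∀ v u, fderiv ℝ (D v) (z + e.symm p) u = e.symm (0, fderiv ℝ f p (e u) v) := by
    intro v u
    have h1 : HasFDerivAt (fun y => e (y - z)) (e : (Fin n → ℝ) →L[ℝ] E₁ × E₂) (z + e.symm p) :=
      e.hasFDerivAt.comp _ ((hasFDerivAt_id _).sub_const z)
    have h2 : HasFDerivAt f (fderiv ℝ f p) (e (z + e.symm p - z)) := by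
      simpa using (hf.differentiable (by simp) p).hasFDerivAt
    have h3 := e.symm.hasFDerivAt.comp (z + e.symm p) ((hasFDerivAt_const v (z + e.symm p)).prodMk
      ((h2.comp (z + e.symm p) h1).clm_apply (hasFDerivAt_const v _)))
    have h4 : fderiv ℝ (D v) (z + e.symm p) = _ := h3.fderiv
    rw [h4]
    simp
  have hb := hinv U hUo (fun y hy => (hU hy).2) (D v) (D w) (hD v).contDiffOn (hD w).contDiffOn
    (hDF v) (hDF w) _ hp
  rw [hFU _ hp, lieBracketVF, hDd, hDd, ← map_sub] at hb
  simpa [D, sub_eq_zero] using hb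

/-- Frobenius theorem, local product structure form: an involutive rank-`r` smooth
distribution `F ⊆ T_X` admits, around each point, a flat chart `φ : U ≅ A × B` in which
`F` is the kernel of the differential of the projection to `B`. -/
theorem stmt16 {n r : ℕ} (hrn : r ≤ n) (X : Set (Fin n → ℝ)) (hX : IsOpen X)
    (F : (Fin n → ℝ) → Submodule ℝ (Fin n → ℝ))
    -- F has rank r:
    (hrank : ∀ x ∈ X, Module.finrank ℝ (F x) = r)
    -- F is smooth: locally spanned by r smooth vector fields:
    (hsmooth : ∀ x ∈ X, ∃ U : Set (Fin n → ℝ), IsOpen U ∧ x ∈ U ∧ U ⊆ X ∧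
      ∃ V : Fin r → ((Fin n → ℝ) → (Fin n → ℝ)),
        (∀ i, ContDiffOn ℝ (⊤ : ℕ∞) (V i) U) ∧
        ∀ y ∈ U, F y = Submodule.span ℝ (Set.range fun i => V i y))
    -- F is involutive: brackets of vector fields with values in F take values in F:
    (hinv : ∀ U : Set (Fin n → ℝ), IsOpen U → U ⊆ X →
      ∀ D E : (Fin n → ℝ) → (Fin n → ℝ),
        ContDiffOn ℝ (⊤ : ℕ∞) D U → ContDiffOn ℝ (⊤ : ℕ∞) E U →
        (∀ y ∈ U, D y ∈ F y) → (∀ y ∈ U, E y ∈ F y) →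
        ∀ y ∈ U, lieBracketVF D E y ∈ F y) :
    ∀ z ∈ X, ∃ U : Set (Fin n → ℝ), IsOpen U ∧ z ∈ U ∧ U ⊆ X ∧
      ∃ (A : Set (Fin r → ℝ)) (B : Set (Fin (n - r) → ℝ)), IsOpen A ∧ IsOpen B ∧
      ∃ φ : (Fin n → ℝ) → (Fin r → ℝ) × (Fin (n - r) → ℝ),
        ContDiffOn ℝ (⊤ : ℕ∞) φ U ∧ Set.InjOn φ U ∧ φ '' U = A ×ˢ B ∧
        (∀ y ∈ U, ∀ v : Fin n → ℝ,
          (v ∈ F y ↔ fderiv ℝ (fun w => (φ w).2) y v = 0)) := by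
  intro z hz
  obtain ⟨U₀, hU₀, hzU₀, -, V, hV, hFV⟩ := hsmooth z hz
  have hU₀z := hU₀.mem_nhds hzU₀
  obtain ⟨e, f, hf, hF⟩ := exists_graph_coordinates hrn (hrank z hz) (V := V)
    (fun i => eventually_of_mem hU₀z fun y hy => (hV i).contDiffAt (hU₀.mem_nhds hy))
    (eventually_of_mem hU₀z hFV)
  obtain ⟨Q, hQs, hQf, hQ0⟩ := exists_first_integrals hf
    (integrable_of_involutive hX hinv hz e hf hF)
  have hψs : ∀ᶠ p in 𝓝 0, ContDiffAt ℝ ∞ (fun p => (p.1, Q p)) p :=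
    hQs.mono fun p hp => contDiffAt_fst.prodMk hp
  have hψ' : HasFDerivAt (fun p => (p.1, Q p)) (((ContinuousLinearEquiv.refl ℝ (Fin r → ℝ)).skewProd
      (ContinuousLinearEquiv.refl ℝ (Fin (n - r) → ℝ))
      ((fderiv ℝ Q 0).comp (ContinuousLinearMap.inl ℝ _ _)) : _ ≃L[ℝ] _) : _ →L[ℝ] _) 0 := by
    refine (hasFDerivAt_fst.prodMk
      (hQs.self_of_nhds.differentiableAt (by simp)).hasFDerivAt).congr_fderiv ?_
    refine ContinuousLinearMap.ext fun q => Prod.ext rfl ?_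
    change fderiv ℝ Q 0 q = q.2 + fderiv ℝ Q 0 (q.1, 0)
    conv_rhs => rw [← hQ0 q.2]
    rw [← map_add]
    simp
  obtain ⟨Ψ, hΨ, h0, hΨs⟩ := exists_openPartialHomeomorph_of_eventually_contDiffAt hψs hψ'
  have hσ0 : Tendsto (fun p => z + e.symm p) (𝓝 0) (𝓝 z) := by
    have : Continuous fun p => z + e.symm p := by fun_prop
    simpa using this.tendsto 0
  obtain ⟨O, hO, hOo, h0O⟩ := mem_nhds_iff.1
    (hF.and (hQf.and (hQs.and (hσ0.eventually (hX.mem_nhds hz)))))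
  let Ψ' := Ψ.restrOpen O hOo
  have hΨ' : ⇑Ψ' = fun p => (p.1, Q p) := hΨ
  have h0' : 0 ∈ Ψ'.source := ⟨h0, h0O⟩
  obtain ⟨A, B, hA, h0A, hB, h0B, hAB⟩ := mem_nhds_prod_iff'.1
    (Ψ'.open_target.mem_nhds (Ψ'.map_source h0'))
  let G := Ψ'.source ∩ Ψ' ⁻¹' (A ×ˢ B)
  have hG : IsOpen G := Ψ'.isOpen_inter_preimage (hA.prod hB)
  have hτ : ContDiff ℝ ∞ fun y => e (y - z) := e.contDiff.comp (contDiff_id.sub contDiff_const)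
  have hGO : ∀ p ∈ G, p ∈ O := fun p hp => hp.1.2
  refine ⟨(fun y => e (y - z)) ⁻¹' G, hG.preimage hτ.continuous, ?_, ?_, A, B, hA, hB,
    fun y => Ψ' (e (y - z)), ?_, ?_, ?_, ?_⟩
  · simpa using (show (0 : (Fin r → ℝ) × (Fin (n - r) → ℝ)) ∈ G from ⟨h0', h0A, h0B⟩)
  · intro y hy
    have : z + e.symm (e (y - z)) ∈ X := (hO (hGO _ hy)).2.2.2
    simpa using this
  · intro y hy
    refine ContDiffAt.contDiffWithinAt (ContDiffAt.comp y ?_ hτ.contDiffAt)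
    change ContDiffAt ℝ ∞ Ψ' _
    rw [hΨ']
    exact (hΨs _ hy.1.1).1
  · intro y hy y' hy' h
    have := Ψ'.injOn hy.1 hy'.1 h
    simpa using this
  · refine Subset.antisymm (image_subset_iff.2 fun y hy => hy.2) fun q hq => ?_
    have hqt := hAB hq
    refine ⟨z + e.symm (Ψ'.symm q), ?_, ?_⟩
    · change e (z + e.symm (Ψ'.symm q) - z) ∈ G
      rw [add_sub_cancel_left, e.apply_symm_apply]
      refine ⟨Ψ'.map_target hqt, ?_⟩
      rw [mem_preimage, Ψ'.right_inv hqt]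
      exact hq
    · simp only [add_sub_cancel_left, e.apply_symm_apply]
      exact Ψ'.right_inv hqt
  · intro y hy v
    obtain ⟨hFy, hQy, hQsy, -⟩ := hO (hGO _ hy)
    obtain ⟨-, d, hd⟩ := hΨs _ hy.1.1
    have hFv : v ∈ F y ↔ (e v).2 = f (e (y - z)) (e v).1 := by simpa using hFy v
    have hQd := (hQsy.differentiableAt (by simp)).hasFDerivAt
    have hτd : HasFDerivAt (fun y => e (y - z))
        (e : (Fin n → ℝ) →L[ℝ] (Fin r → ℝ) × (Fin (n - r) → ℝ)) y :=
      e.hasFDerivAt.comp _ ((hasFDerivAt_id _).sub_const z)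
    have hfd : fderiv ℝ (fun w => (Ψ' (e (w - z))).2) y v = fderiv ℝ Q (e (y - z)) (e v) := by
      rw [hΨ', show (fun w => ((e (w - z)).1, Q (e (w - z))).2) = fun w => Q (e (w - z)) from rfl]
      rw [show (fun w => Q (e (w - z))) = Q ∘ fun w => e (w - z) from rfl, (hQd.comp y hτd).fderiv]
      rfl
    have hdv : ∀ u, d u = (u.1, fderiv ℝ Q (e (y - z)) u) := fun u =>
      congrArg (· u) (hd.unique (hasFDerivAt_fst.prodMk hQd))
    have hsplit : fderiv ℝ Q (e (y - z)) (e v) =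
        fderiv ℝ Q (e (y - z)) (0, (e v).2 - f (e (y - z)) (e v).1) := by
      rw [← sub_eq_zero, ← map_sub, ← hQy (e v).1]
      congr 1
      ext <;> simp
    rw [hFv, hfd, hsplit, ← sub_eq_zero]
    constructor
    · intro h
      rw [h]
      exact map_zero _
    · intro h
      have : d (0, (e v).2 - f (e (y - z)) (e v).1) = 0 := by rw [hdv, h]; rfl
      exact congrArg Prod.snd (d.map_eq_zero_iff.1 this)
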